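/- arXiv:1712.01824 — 2 statements merged into one kernel-verified Lean document; each statement's English description precedes it below -/
import Mathlib

section
/- Let β > 0, ρ ∈ [0, 1/2], μ ∈ (0, 2π], and θ ∈ (0, 2π], and suppose |sin(θ − μ)| ≠ |sin(μ)|. Define M₀(θ) = 1 if |sin(θ − μ)| ≥ |sin(μ)| and 0 otherwise, and M₁(θ) = 1 − M₀(θ). Then the iterated series ∑_{k=0}^∞ ∑_{s=0}^{k} C(β, k)·C(k, s)·(1/(2π))^(β−k)·(ρ/π)^k·θ^(β−k)·[ (sin μ)^s·(sin(θ − μ))^(k−s)·M₀(θ) + (sin μ)^(k−s)·(sin(θ − μ))^s·M₁(θ) ] converges with sum equal to F(θ) = (θ/(2π) + (ρ/π)·(sin(θ − μ) + sin(μ)))^β. -/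
open Real

/-- Generalized binomial coefficient `C(β, k) = β (β-1) ⋯ (β-k+1) / k!`. -/
noncomputable def genBinom (β : ℝ) (k : ℕ) : ℝ :=
  (∏ i ∈ Finset.range k, (β - i)) / (Nat.factorial k)

theorem genBinom_eq_choose (β : ℝ) (k : ℕ) : genBinom β k = Ring.choose β k := by
  rw [Ring.choose_eq_smul, genBinom, ← Polynomial.aeval_eq_smeval, Polynomial.aeval_def,
    ← Polynomial.eval_map, descPochhammer_map, descPochhammer_eval_eq_prod_range]
  simp [div_eq_inv_mul]

theorem genBinom_hasSum (β x : ℝ) (hx : |x| < 1) :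
    HasSum (fun k : ℕ => genBinom β k * x ^ k) ((1 + x) ^ β) := by
  have h := (Real.one_add_rpow_hasFPowerSeriesOnBall_zero (a := β)).hasSum (y := x) (by
    simpa [enorm_eq_nnnorm, ← NNReal.coe_lt_coe] using hx)
  rw [zero_add] at h
  have hf : (fun k : ℕ => genBinom β k * x ^ k) =
      fun n => (binomialSeries ℝ β n) fun _ => x := by
    funext k
    rw [binomialSeries_apply, genBinom_eq_choose]
    simp
  rw [hf]
  exact h

theorem abs_sin_sum_lt (μ θ : ℝ) (hθ0 : 0 < θ) :
    |Real.sin (θ - μ) + Real.sin μ| < θ := by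
  have h1 : Real.sin (θ - μ) + Real.sin μ = 2 * Real.sin (θ / 2) * Real.cos (θ / 2 - μ) := by
    have e1 : θ - μ = θ / 2 + (θ / 2 - μ) := by ring
    have e2 : μ = θ / 2 - (θ / 2 - μ) := by ring
    have s1 : Real.sin (θ - μ) = _ := (congrArg Real.sin e1).trans (Real.sin_add _ _)
    have s2 : Real.sin μ = _ := (congrArg Real.sin e2).trans (Real.sin_sub _ _)
    linarith
  have h2 : |Real.sin (θ / 2)| < θ / 2 := by
    have := Real.abs_sin_lt_abs (x := θ / 2) (by positivity)
    rwa [abs_of_pos (by positivity : 0 < θ / 2)] at this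
  have h3 := Real.abs_cos_le_one (θ / 2 - μ)
  rw [h1, abs_mul, abs_mul, abs_two]
  nlinarith [abs_nonneg (Real.sin (θ / 2)), abs_nonneg (Real.cos (θ / 2 - μ))]

theorem ec_cdf_double_series (β ρ μ θ : ℝ) (hβ : 0 < β) (hρ0 : 0 ≤ ρ) (hρ1 : ρ ≤ 1 / 2)
    (hμ0 : 0 < μ) (hμ1 : μ ≤ 2 * π) (hθ0 : 0 < θ) (hθ1 : θ ≤ 2 * π)
    (hne : |Real.sin (θ - μ)| ≠ |Real.sin μ|) :
    HasSum
      (fun k : ℕ => ∑ s ∈ Finset.range (k + 1),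
        genBinom β k * (Nat.choose k s : ℝ) * (1 / (2 * π)) ^ (β - (k : ℝ)) *
          (ρ / π) ^ k * θ ^ (β - (k : ℝ)) *
          ((Real.sin μ) ^ s * (Real.sin (θ - μ)) ^ (k - s) *
              (if |Real.sin (θ - μ)| ≥ |Real.sin μ| then (1 : ℝ) else 0) +
            (Real.sin μ) ^ (k - s) * (Real.sin (θ - μ)) ^ s *
              (1 - if |Real.sin (θ - μ)| ≥ |Real.sin μ| then (1 : ℝ) else 0)))
      ((θ / (2 * π) + (ρ / π) * (Real.sin (θ - μ) + Real.sin μ)) ^ β) := by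
  have hπ := Real.pi_pos
  set a := Real.sin (θ - μ) with ha
  set b := Real.sin μ with hb
  have hS : |a + b| < θ := abs_sin_sum_lt μ θ hθ0
  have hx : |2 * ρ * (a + b) / θ| < 1 := by
    rw [abs_div, abs_of_pos hθ0, div_lt_one hθ0, abs_mul, abs_of_nonneg (by positivity)]
    nlinarith [abs_nonneg (a + b)]
  have h := (genBinom_hasSum β _ hx).mul_left ((θ / (2 * π)) ^ β)
  have hpos : 0 ≤ 1 + 2 * ρ * (a + b) / θ := by linarith [(abs_lt.mp hx).1]
  rw [← Real.mul_rpow (by positivity) hpos] at h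
  have e : θ / (2 * π) * (1 + 2 * ρ * (a + b) / θ) = θ / (2 * π) + ρ / π * (a + b) := by
    field_simp
  rw [e] at h
  refine Eq.mpr (congrArg (fun f => HasSum f _) (funext fun k => ?_)) h
  have key : ∀ s ∈ Finset.range (k + 1),
      genBinom β k * (Nat.choose k s : ℝ) * (1 / (2 * π)) ^ (β - (k : ℝ)) *
          (ρ / π) ^ k * θ ^ (β - (k : ℝ)) *
          (b ^ s * a ^ (k - s) * (if |a| ≥ |b| then (1 : ℝ) else 0) +
            b ^ (k - s) * a ^ s * (1 - if |a| ≥ |b| then (1 : ℝ) else 0)) =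
      (genBinom β k * (1 / (2 * π)) ^ (β - (k : ℝ)) * (ρ / π) ^ k * θ ^ (β - (k : ℝ))) *
        ((b ^ s * a ^ (k - s) * (Nat.choose k s : ℝ)) * (if |a| ≥ |b| then (1 : ℝ) else 0) +
          (a ^ s * b ^ (k - s) * (Nat.choose k s : ℝ)) *
            (1 - if |a| ≥ |b| then (1 : ℝ) else 0)) := by
    intro s _; ring
  rw [Finset.sum_congr rfl key, ← Finset.mul_sum, Finset.sum_add_distrib, ← Finset.sum_mul,
    ← Finset.sum_mul, ← add_pow, ← add_pow, add_comm b a, ← mul_add, add_sub_cancel, mul_one]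
  have e2 : (1 / (2 * π)) ^ (β - (k : ℝ)) * θ ^ (β - (k : ℝ)) =
      (θ / (2 * π)) ^ β / (θ / (2 * π)) ^ k := by
    rw [← Real.mul_rpow (by positivity) hθ0.le, one_div_mul_eq_div,
      Real.rpow_sub (by positivity), Real.rpow_natCast]
  have e3 : (ρ / π) ^ k * (a + b) ^ k = (2 * ρ * (a + b) / θ) ^ k * (θ / (2 * π)) ^ k := by
    rw [← mul_pow, ← mul_pow]; congr 1; field_simp
  have hne0 : (θ / (2 * π)) ^ k ≠ 0 := by positivity
  calc _ = genBinom β k * ((1 / (2 * π)) ^ (β - (k : ℝ)) * θ ^ (β - (k : ℝ))) *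
        ((ρ / π) ^ k * (a + b) ^ k) := by ring
    _ = _ := by rw [e2, e3]; field_simp
end

section
/- Let β > 0, ρ > 0, α ∈ (0, 1], and μ ∈ ℝ. Define C = α^(1/β) − (ρ/π)·(sin(μ) − (μ/2)·(π + μ) + (8 − π²)/8), D = (1 + πρ + 2ρμ)/(2π), and E = D² − 2ρC/π. If E ≥ 0, then Q := (π/ρ)·(D − √E) satisfies α^(1/β) = Q/(2π) + (ρ/π)·(−(1/2)·(Q − μ)² + (π/2)·(Q − μ) + (8 − π²)/8 + sin(μ)). -/
open Real

theorem ec_quantile_item2 (β ρ α μ : ℝ) (hβ : 0 < β) (hρ : 0 < ρ)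
    (hα0 : 0 < α) (hα1 : α ≤ 1)
    (C D E : ℝ)
    (hC : C = α ^ (1 / β) - (ρ / π) * (Real.sin μ - (μ / 2) * (π + μ) + (8 - π ^ 2) / 8))
    (hD : D = (1 + π * ρ + 2 * ρ * μ) / (2 * π))
    (hE : E = D ^ 2 - 2 * ρ * C / π)
    (hE0 : 0 ≤ E) :
    α ^ (1 / β) =
      ((π / ρ) * (D - Real.sqrt E)) / (2 * π) +
        (ρ / π) * (-(1 / 2) * ((π / ρ) * (D - Real.sqrt E) - μ) ^ 2 +
          (π / 2) * ((π / ρ) * (D - Real.sqrt E) - μ) + (8 - π ^ 2) / 8 + Real.sin μ) := by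
  have hπ : π ≠ 0 := Real.pi_ne_zero
  have hρ' : ρ ≠ 0 := hρ.ne'
  have hs : Real.sqrt E ^ 2 = E := Real.sq_sqrt hE0
  generalize Real.sqrt E = s at *
  generalize α ^ (1 / β) = A at *
  obtain ⟨Q, hQ⟩ : ∃ Q, Q = (π / ρ) * (D - s) := ⟨_, rfl⟩
  rw [← hQ]
  have key : C = Q * D - ρ / (2 * π) * Q ^ 2 := by
    have h1 : C = π / (2 * ρ) * (D ^ 2 - s ^ 2) := by
      rw [hs, hE]
      field_simp
      ring
    rw [h1, hQ]
    field_simp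
    ring
  have hA : A = C + (ρ / π) * (Real.sin μ - (μ / 2) * (π + μ) + (8 - π ^ 2) / 8) := by
    rw [hC]; ring
  rw [hA, key, hD]
  field_simp
  ring
end
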